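/- Let {pᵢ} be a frame for H with bounds A, B and frame operator S_F, and {qⱼ} a frame for K with bounds C, D and frame operator S_G. Let S = S_F ⊗ S_G be the frame operator of {pᵢ ⊗ qⱼ} on H ⊗ K. Then {S⁻¹(pᵢ ⊗ qⱼ)}ᵢ,ⱼ is a frame for H ⊗ K with bounds AC/(B²D²) and BD/(A²C²), and its frame operator is S⁻¹. -/

import Mathlib

open scoped RealInnerProductSpace

/-- `IsHilbertTensorProduct tmul` says that the continuous bilinear map
`tmul : H →L K →L E` realizes `E` as the Hilbert space tensor product `H ⊗ K`:
`⟨p ⊗ q, p' ⊗ q'⟩ = ⟨p, p'⟩⟨q, q'⟩` and the elementary tensors span a dense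
subspace of `E`. -/
def IsHilbertTensorProduct {H K E : Type*}
    [NormedAddCommGroup H] [InnerProductSpace ℝ H]
    [NormedAddCommGroup K] [InnerProductSpace ℝ K]
    [NormedAddCommGroup E] [InnerProductSpace ℝ E]
    (tmul : H →L[ℝ] K →L[ℝ] E) : Prop :=
  (∀ (p p' : H) (q q' : K), ⟪tmul p q, tmul p' q'⟫ = ⟪p, p'⟫ * ⟪q, q'⟫) ∧
  Dense ((Submodule.span ℝ (Set.range fun z : H × K => tmul z.1 z.2) : Submodule ℝ E) : Set E)

/-- `IsFrameWith A B f`: the family `f` is a frame with frame bounds `A ≤ B`,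
i.e. `A‖x‖² ≤ Σᵢ |⟨x, fᵢ⟩|² ≤ B‖x‖²` for all `x`. -/
def IsFrameWith {ι X : Type*} [NormedAddCommGroup X] [InnerProductSpace ℝ X]
    (A B : ℝ) (f : ι → X) : Prop :=
  0 < A ∧ A ≤ B ∧
    ∀ x : X, A * ‖x‖ ^ 2 ≤ (∑' i : ι, ⟪x, f i⟫ ^ 2) ∧
      (∑' i : ι, ⟪x, f i⟫ ^ 2) ≤ B * ‖x‖ ^ 2

open ContinuousLinearMap InnerProductSpace Filter Topology

section PositiveOperators

variable {X : Type*} [NormedAddCommGroup X] [InnerProductSpace ℝ X]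

theorem ContinuousLinearMap.IsPositive.posSemidef_inner {P : X →L[ℝ] X} (hP : P.IsPositive)
    {ι : Type*} [Fintype ι] (x : ι → X) :
    (Matrix.of fun a b => ⟪P (x a), x b⟫).PosSemidef := by
  refine .of_dotProduct_mulVec_nonneg ?_ fun c => ?_
  · ext a b
    rw [Matrix.conjTranspose_apply, Matrix.of_apply, Matrix.of_apply, star_trivial,
      hP.inner_left_eq_inner_right, real_inner_comm]
  · have h := hP.inner_nonneg_left (∑ a, c a • x a)
    simp only [map_sum, map_smul, sum_inner, inner_sum, real_inner_smul_left,
      real_inner_smul_right] at h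
    simp only [dotProduct, Matrix.mulVec, Matrix.of_apply, star_trivial, Finset.mul_sum]
    refine h.trans_eq (Finset.sum_congr rfl fun a _ => Finset.sum_congr rfl fun b _ => ?_)
    rw [real_inner_comm, hP.inner_left_eq_inner_right]
    ring

theorem ContinuousLinearMap.inner_apply_self_le (T : X →L[ℝ] X) (x : X) :
    ⟪T x, x⟫ ≤ ‖T‖ * ‖x‖ ^ 2 := by
  refine (real_inner_le_norm _ _).trans ?_
  rw [pow_two, ← mul_assoc]
  gcongr
  exact T.le_opNorm x

theorem ContinuousLinearMap.IsPositive.norm_apply_sq_le {R : X →L[ℝ] X} (hR : R.IsPositive)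
    {c : ℝ} (hc : ∀ y, ⟪R y, y⟫ ≤ c * ‖y‖ ^ 2) (x : X) : ‖R x‖ ^ 2 ≤ c * ⟪R x, x⟫ := by
  have hcs := LinearMap.BilinForm.apply_mul_apply_le_of_forall_zero_le
    ((innerₗ X).comp R.toLinearMap) (fun y => by simpa using hR.inner_nonneg_left y) x (R x)
  simp only [LinearMap.comp_apply, coe_coe, innerₗ_apply_apply,
    hR.inner_left_eq_inner_right (R x) x, real_inner_self_eq_norm_sq] at hcs
  rcases (sq_nonneg ‖R x‖).eq_or_lt with h0 | hpos
  · have hRx : R x = 0 := by simpa using h0.symm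
    simp [hRx]
  · refine le_of_mul_le_mul_right ?_ hpos
    nlinarith [mul_le_mul_of_nonneg_left (hc (R x)) (hR.inner_nonneg_left x)]

end PositiveOperators

section FrameOperators

variable {ι X : Type*} [NormedAddCommGroup X] [InnerProductSpace ℝ X] {f : ι → X}
  {S : X →L[ℝ] X}

/-- The partial frame operator `x ↦ ∑ i ∈ s, ⟪x, f i⟫ • f i` of a family over a finite set. -/
noncomputable def partialFrameOperator (f : ι → X) (s : Finset ι) : X →L[ℝ] X :=
  ∑ i ∈ s, rankOne ℝ (f i) (f i)

theorem partialFrameOperator_apply (f : ι → X) (s : Finset ι) (x : X) :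
    partialFrameOperator f s x = ∑ i ∈ s, ⟪x, f i⟫ • f i := by
  simp [partialFrameOperator, real_inner_comm]

theorem inner_partialFrameOperator_apply_self (f : ι → X) (s : Finset ι) (x : X) :
    ⟪partialFrameOperator f s x, x⟫ = ∑ i ∈ s, ⟪x, f i⟫ ^ 2 := by
  simp only [partialFrameOperator_apply, sum_inner, real_inner_smul_left, pow_two]
  exact Finset.sum_congr rfl fun i _ => by rw [real_inner_comm x (f i)]

theorem isPositive_partialFrameOperator (f : ι → X) (s : Finset ι) :
    (partialFrameOperator f s).IsPositive :=
  isPositive_sum s fun i _ => isPositive_rankOne_self (f i)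

theorem hasSum_inner_sq (hS : ∀ x, HasSum (fun i => ⟪x, f i⟫ • f i) (S x)) (x : X) :
    HasSum (fun i => ⟪x, f i⟫ ^ 2) ⟪S x, x⟫ := by
  have h := (hS x).mapL (innerSL ℝ x)
  simpa [real_inner_comm x, pow_two, real_inner_smul_right] using h

theorem isSymmetric_of_hasSum (hS : ∀ x, HasSum (fun i => ⟪x, f i⟫ • f i) (S x)) :
    (S : X →ₗ[ℝ] X).IsSymmetric := by
  intro x y
  have h₁ := (hS x).mapL (innerSL ℝ y)
  have h₂ := (hS y).mapL (innerSL ℝ x)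
  simp only [innerSL_apply_apply, real_inner_smul_right] at h₁ h₂
  rw [coe_coe, real_inner_comm]
  exact h₁.unique (by simpa only [mul_comm] using h₂)

theorem isPositive_sub_partialFrameOperator
    (hS : ∀ x, HasSum (fun i => ⟪x, f i⟫ • f i) (S x)) (s : Finset ι) :
    (S - partialFrameOperator f s).IsPositive := by
  refine (isPositive_iff _).2
    ⟨(isSymmetric_of_hasSum hS).sub (isPositive_partialFrameOperator f s).isSymmetric,
      fun x => ?_⟩
  rw [sub_apply, inner_sub_left, inner_partialFrameOperator_apply_self, sub_nonneg]
  exact sum_le_hasSum s (fun i _ => sq_nonneg _) (hasSum_inner_sq hS x)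

theorem isPositive_of_hasSum (hS : ∀ x, HasSum (fun i => ⟪x, f i⟫ • f i) (S x)) :
    S.IsPositive := by
  simpa [partialFrameOperator] using isPositive_sub_partialFrameOperator hS ∅

theorem IsFrameWith.isPositive_sub_smul {A B : ℝ} (hf : IsFrameWith A B f)
    (hS : ∀ x, HasSum (fun i => ⟪x, f i⟫ • f i) (S x)) :
    (S - A • (1 : X →L[ℝ] X)).IsPositive := by
  refine (isPositive_iff _).2 ⟨(isSymmetric_of_hasSum hS).sub
    (isPositive_one.smul_of_nonneg hf.1.le).isSymmetric, fun x => ?_⟩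
  have h := (hf.2.2 x).1
  rw [(hasSum_inner_sq hS x).tsum_eq] at h
  simpa [inner_sub_left, real_inner_smul_left, real_inner_self_eq_norm_sq] using h

theorem IsFrameWith.isPositive_smul_sub {A B : ℝ} (hf : IsFrameWith A B f)
    (hS : ∀ x, HasSum (fun i => ⟪x, f i⟫ • f i) (S x)) :
    (B • (1 : X →L[ℝ] X) - S).IsPositive := by
  refine (isPositive_iff _).2 ⟨(isPositive_one.smul_of_nonneg
    (hf.1.le.trans hf.2.1)).isSymmetric.sub (isSymmetric_of_hasSum hS), fun x => ?_⟩
  have h := (hf.2.2 x).2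
  rw [(hasSum_inner_sq hS x).tsum_eq] at h
  simpa [inner_sub_left, real_inner_smul_left, real_inner_self_eq_norm_sq] using h

/-- If `S` dominates all partial frame operators of `f` and the quadratic forms converge to that
of `S` on a set with dense span, then `S` is the frame operator of `f`. -/
theorem hasSum_of_isPositive_sub_partialFrameOperator
    (hpos : ∀ s, (S - partialFrameOperator f s).IsPositive) {V : Set X}
    (hV : Dense (Submodule.span ℝ V : Set X))
    (hsum : ∀ v ∈ V, HasSum (fun i => ⟪v, f i⟫ ^ 2) ⟪S v, v⟫) (x : X) :
    HasSum (fun i => ⟪x, f i⟫ • f i) (S x) := by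
  set R : Finset ι → X →L[ℝ] X := fun s => S - partialFrameOperator f s with hR
  have hle (s : Finset ι) (y : X) : ⟪R s y, y⟫ ≤ ‖S‖ * ‖y‖ ^ 2 := by
    have h := (isPositive_partialFrameOperator f s).inner_nonneg_left y
    rw [hR, sub_apply, inner_sub_left]
    linarith [S.inner_apply_self_le y]
  have hsq (s : Finset ι) (y : X) : ‖R s y‖ ^ 2 ≤ ‖S‖ * ⟪R s y, y⟫ :=
    (hpos s).norm_apply_sq_le (hle s) y
  have hbound (s : Finset ι) (y : X) : ‖R s y‖ ≤ ‖S‖ * ‖y‖ := by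
    refine (abs_le_of_sq_le_sq' ?_ (by positivity)).2
    nlinarith [hsq s y, mul_le_mul_of_nonneg_left (hle s y) (norm_nonneg S)]
  have hspan (y : X) (hy : y ∈ Submodule.span ℝ V) : Tendsto (fun s => R s y) atTop (𝓝 0) := by
    induction hy using Submodule.span_induction with
    | zero => simp
    | add y z _ _ hy hz => simpa using hy.add hz
    | smul c y _ hy => simpa using hy.const_smul c
    | mem v hv =>
      have hq : Tendsto (fun s => ‖S‖ * ⟪R s v, v⟫) atTop (𝓝 0) := by
        have h : Tendsto (fun s => ∑ i ∈ s, ⟪v, f i⟫ ^ 2) atTop (𝓝 ⟪S v, v⟫) := hsum v hv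
        simpa [hR, inner_sub_left, inner_partialFrameOperator_apply_self] using
          (h.const_sub ⟪S v, v⟫).const_mul ‖S‖
      have h := (squeeze_zero (fun s => by positivity) (fun s => hsq s v) hq).sqrt
      rw [tendsto_zero_iff_norm_tendsto_zero]
      simpa using h
  have hlim : Tendsto (fun s => R s x) atTop (𝓝 0) := by
    rw [Metric.tendsto_nhds]
    intro ε hε
    obtain ⟨y, hy, hxy⟩ := hV.exists_dist_lt x (ε := ε / (2 * (‖S‖ + 1))) (by positivity)
    filter_upwards [Metric.tendsto_nhds.1 (hspan y hy) (ε / 2) (by positivity)] with s hs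
    rw [dist_zero_right] at hs ⊢
    rw [dist_eq_norm, lt_div_iff₀ (by positivity)] at hxy
    have h := hbound s (x - y)
    have h' : ‖R s x‖ ≤ ‖R s (x - y)‖ + ‖R s y‖ := by
      simpa using norm_add_le (R s (x - y)) (R s y)
    nlinarith [norm_nonneg (x - y)]
  have h := hlim.const_sub (S x)
  simpa [hR, partialFrameOperator_apply, HasSum] using h

end FrameOperators

namespace IsHilbertTensorProduct

variable {H K E : Type*}
  [NormedAddCommGroup H] [InnerProductSpace ℝ H]
  [NormedAddCommGroup K] [InnerProductSpace ℝ K]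
  [NormedAddCommGroup E] [InnerProductSpace ℝ E]
  {tmul : H →L[ℝ] K →L[ℝ] E}

/-- A bounded operator on `H ⊗ K` that acts as `P₁ ⊗ Q₁ + P₂ ⊗ Q₂` for positive `Pᵢ`, `Qᵢ` is
positive. -/
theorem isPositive (htp : IsHilbertTensorProduct tmul) {P₁ P₂ : H →L[ℝ] H} {Q₁ Q₂ : K →L[ℝ] K}
    (hP₁ : P₁.IsPositive) (hQ₁ : Q₁.IsPositive) (hP₂ : P₂.IsPositive) (hQ₂ : Q₂.IsPositive)
    {T : E →L[ℝ] E}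
    (hT : ∀ x y, T (tmul x y) = tmul (P₁ x) (Q₁ y) + tmul (P₂ x) (Q₂ y)) :
    T.IsPositive := by
  obtain ⟨hinner, hdense⟩ := htp
  refine (isPositive_iff _).2 ⟨fun u v => ?_, fun u => ?_⟩
  · rw [coe_coe]
    induction u using hdense.induction with
    | isClosed => exact isClosed_eq (by fun_prop) (by fun_prop)
    | mem u hu =>
    induction v using hdense.induction with
    | isClosed => exact isClosed_eq (by fun_prop) (by fun_prop)
    | mem v hv =>
    induction hu, hv using Submodule.span_induction₂ with
    | mem_mem u v hu hv =>
      obtain ⟨⟨x, y⟩, rfl⟩ := hu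
      obtain ⟨⟨x', y'⟩, rfl⟩ := hv
      simp only [hT, inner_add_left, inner_add_right, hinner, hP₁.inner_left_eq_inner_right,
        hP₂.inner_left_eq_inner_right, hQ₁.inner_left_eq_inner_right,
        hQ₂.inner_left_eq_inner_right]
    | zero_left => simp
    | zero_right => simp
    | add_left u v w _ _ _ h₁ h₂ => simp only [map_add, inner_add_left, h₁, h₂]
    | add_right u v w _ _ _ h₁ h₂ => simp only [map_add, inner_add_right, h₁, h₂]
    | smul_left c u v _ _ h => simp only [map_smul, real_inner_smul_left, h]
    | smul_right c u v _ _ h => simp only [map_smul, real_inner_smul_right, h]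
  · induction u using hdense.induction with
    | isClosed => exact isClosed_le (by fun_prop) (by fun_prop)
    | mem u hu =>
      obtain ⟨c, rfl⟩ := Finsupp.mem_span_range_iff_exists_finsupp.1 hu
      have hschur {P : H →L[ℝ] H} {Q : K →L[ℝ] K} (hP : P.IsPositive) (hQ : Q.IsPositive) :
          0 ≤ ∑ b : c.support, ∑ a : c.support, c b * (c a *
            (⟪P (a : H × K).1, (b : H × K).1⟫ * ⟪Q (a : H × K).2, (b : H × K).2⟫)) := by
        have h := ((hP.posSemidef_inner fun a : c.support => (a : H × K).1).hadamard
          (hQ.posSemidef_inner fun a : c.support => (a : H × K).2)).dotProduct_mulVec_nonneg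
            fun a => c a
        simp only [dotProduct, Matrix.mulVec, Matrix.hadamard_apply, Matrix.of_apply,
          star_trivial, Finset.mul_sum] at h
        rw [Finset.sum_comm] at h
        refine h.trans_eq (Finset.sum_congr rfl fun b _ => Finset.sum_congr rfl fun a _ => ?_)
        ring
      have h := add_nonneg (hschur hP₁ hQ₁) (hschur hP₂ hQ₂)
      rw [Finsupp.sum, ← Finset.sum_coe_sort]
      simpa only [map_sum, map_smul, hT, sum_inner, inner_sum, real_inner_smul_left,
        real_inner_smul_right, inner_add_left, hinner, mul_add, Finset.sum_add_distrib] using h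

variable {ι κ : Type*} {p : ι → H} {q : κ → K} {SF : H →L[ℝ] H} {SG : K →L[ℝ] K} {S : E →L[ℝ] E}

theorem isPositive_sub_partialFrameOperator (htp : IsHilbertTensorProduct tmul)
    (hSF : ∀ x, HasSum (fun i => ⟪x, p i⟫ • p i) (SF x))
    (hSG : ∀ y, HasSum (fun j => ⟪y, q j⟫ • q j) (SG y))
    (hS : ∀ x y, S (tmul x y) = tmul (SF x) (SG y)) (s : Finset (ι × κ)) :
    (S - partialFrameOperator (fun ij : ι × κ => tmul (p ij.1) (q ij.2)) s).IsPositive := by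
  classical
  set e := fun ij : ι × κ => tmul (p ij.1) (q ij.2)
  set s₁ := s.image Prod.fst
  set s₂ := s.image Prod.snd
  have hprod : (S - partialFrameOperator e (s₁ ×ˢ s₂)).IsPositive := by
    refine htp.isPositive (_root_.isPositive_sub_partialFrameOperator hSF s₁)
      (isPositive_of_hasSum hSG) (isPositive_partialFrameOperator p s₁)
      (_root_.isPositive_sub_partialFrameOperator hSG s₂) fun x y => ?_
    have h : partialFrameOperator e (s₁ ×ˢ s₂) (tmul x y) =
        tmul (partialFrameOperator p s₁ x) (partialFrameOperator q s₂ y) := by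
      simp only [partialFrameOperator_apply, e, htp.1, map_sum, map_smul, sum_apply, smul_apply,
        Finset.sum_product, Finset.smul_sum, smul_smul]
      rw [Finset.sum_comm]
      simp only [mul_comm]
    simp only [sub_apply, map_sub, h, hS]
    abel
  have hrest : (partialFrameOperator e (s₁ ×ˢ s₂) - partialFrameOperator e s).IsPositive := by
    have hsub : s ⊆ s₁ ×ˢ s₂ := Finset.subset_product
    rw [partialFrameOperator, partialFrameOperator, ← Finset.sum_sdiff hsub, add_sub_cancel_right]
    exact isPositive_partialFrameOperator e _
  simpa using hprod.add hrest

/-- `S_F ⊗ S_G` is the frame operator of the family `p i ⊗ q j`. -/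
theorem hasSum_frameOperator (htp : IsHilbertTensorProduct tmul)
    (hSF : ∀ x, HasSum (fun i => ⟪x, p i⟫ • p i) (SF x))
    (hSG : ∀ y, HasSum (fun j => ⟪y, q j⟫ • q j) (SG y))
    (hS : ∀ x y, S (tmul x y) = tmul (SF x) (SG y)) (u : E) :
    HasSum (fun ij : ι × κ => ⟪u, tmul (p ij.1) (q ij.2)⟫ • tmul (p ij.1) (q ij.2)) (S u) := by
  refine hasSum_of_isPositive_sub_partialFrameOperator
    (htp.isPositive_sub_partialFrameOperator hSF hSG hS) htp.2 ?_ u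
  rintro _ ⟨⟨x, y⟩, rfl⟩
  have hx := hasSum_inner_sq hSF x
  have hy := hasSum_inner_sq hSG y
  have h := hx.mul hy (hx.summable.mul_of_nonneg hy.summable (fun i => sq_nonneg _)
    fun j => sq_nonneg _)
  simpa only [hS, htp.1, mul_pow] using h

theorem le_inner_frameOperator (htp : IsHilbertTensorProduct tmul) {A B C D : ℝ}
    (hp : IsFrameWith A B p) (hq : IsFrameWith C D q)
    (hSF : ∀ x, HasSum (fun i => ⟪x, p i⟫ • p i) (SF x))
    (hSG : ∀ y, HasSum (fun j => ⟪y, q j⟫ • q j) (SG y))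
    (hS : ∀ x y, S (tmul x y) = tmul (SF x) (SG y)) (u : E) :
    A * C * ‖u‖ ^ 2 ≤ ⟪S u, u⟫ := by
  have h := (htp.isPositive (T := S - (A * C) • 1) (hp.isPositive_sub_smul hSF)
    (isPositive_of_hasSum hSG) (isPositive_one.smul_of_nonneg hp.1.le)
    (hq.isPositive_sub_smul hSG) fun x y => by
      simp [hS, smul_sub, mul_smul]).inner_nonneg_left u
  simpa [inner_sub_left, real_inner_smul_left, real_inner_self_eq_norm_sq] using h

theorem inner_frameOperator_le (htp : IsHilbertTensorProduct tmul) {A B C D : ℝ}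
    (hp : IsFrameWith A B p) (hq : IsFrameWith C D q)
    (hSF : ∀ x, HasSum (fun i => ⟪x, p i⟫ • p i) (SF x))
    (hSG : ∀ y, HasSum (fun j => ⟪y, q j⟫ • q j) (SG y))
    (hS : ∀ x y, S (tmul x y) = tmul (SF x) (SG y)) (u : E) :
    ⟪S u, u⟫ ≤ B * D * ‖u‖ ^ 2 := by
  have h := (htp.isPositive (T := (B * D) • 1 - S) (hp.isPositive_smul_sub hSF)
    (isPositive_one.smul_of_nonneg (hq.1.le.trans hq.2.1)) (isPositive_of_hasSum hSF)
    (hq.isPositive_smul_sub hSG) fun x y => by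
      simp [hS, smul_sub, mul_smul, smul_comm B D]).inner_nonneg_left u
  simpa [inner_sub_left, real_inner_smul_left, real_inner_self_eq_norm_sq] using h

end IsHilbertTensorProduct

/-- if `S = S_F ⊗ S_G` is the frame operator of `{pᵢ ⊗ qⱼ}`, then
`{S⁻¹(pᵢ ⊗ qⱼ)}` is a frame for `H ⊗ K` with bounds `AC/(B²D²)` and `BD/(A²C²)`,
and its frame operator is `S⁻¹`. -/
theorem tensor_canonical_dual_frame {H K E : Type*}
    [NormedAddCommGroup H] [InnerProductSpace ℝ H] [CompleteSpace H]
    [NormedAddCommGroup K] [InnerProductSpace ℝ K] [CompleteSpace K]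
    [NormedAddCommGroup E] [InnerProductSpace ℝ E] [CompleteSpace E]
    (tmul : H →L[ℝ] K →L[ℝ] E) (htp : IsHilbertTensorProduct tmul)
    (p_ : ℕ → H) (q_ : ℕ → K) (A B C D : ℝ)
    (hpf : IsFrameWith A B p_) (hqf : IsFrameWith C D q_)
    (SF : H →L[ℝ] H) (hSF : ∀ x : H, HasSum (fun i : ℕ => ⟪x, p_ i⟫ • p_ i) (SF x))
    (SG : K →L[ℝ] K) (hSG : ∀ y : K, HasSum (fun j : ℕ => ⟪y, q_ j⟫ • q_ j) (SG y))
    (S : E →L[ℝ] E)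
    (hS : ∀ (f : H) (g : K), S (tmul f g) = tmul (SF f) (SG g))
    (Sinv : E →L[ℝ] E)
    (hS1 : S.comp Sinv = ContinuousLinearMap.id ℝ E)
    (hS2 : Sinv.comp S = ContinuousLinearMap.id ℝ E) :
    IsFrameWith (A * C / (B ^ 2 * D ^ 2)) (B * D / (A ^ 2 * C ^ 2))
      (fun ij : ℕ × ℕ => Sinv (tmul (p_ ij.1) (q_ ij.2))) ∧
    ∀ u : E, HasSum
      (fun ij : ℕ × ℕ =>
        ⟪u, Sinv (tmul (p_ ij.1) (q_ ij.2))⟫ • Sinv (tmul (p_ ij.1) (q_ ij.2)))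
      (Sinv u) := by
  have hSSinv (u : E) : S (Sinv u) = u := DFunLike.congr_fun hS1 u
  have hSinvS (u : E) : Sinv (S u) = u := DFunLike.congr_fun hS2 u
  have hframe := htp.hasSum_frameOperator hSF hSG hS
  have hlow := htp.le_inner_frameOperator hpf hqf hSF hSG hS
  have hupp := htp.inner_frameOperator_le hpf hqf hSF hSG hS
  have hpos : S.IsPositive := isPositive_of_hasSum hframe
  have hadj (u v : E) : ⟪u, Sinv v⟫ = ⟪Sinv u, v⟫ := by
    conv_lhs => rw [← hSSinv u]
    rw [hpos.inner_left_eq_inner_right, hSSinv]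
  have hdual (u : E) : HasSum (fun ij : ℕ × ℕ =>
      ⟪u, Sinv (tmul (p_ ij.1) (q_ ij.2))⟫ • Sinv (tmul (p_ ij.1) (q_ ij.2))) (Sinv u) := by
    simpa only [hSSinv, hadj, map_smul] using (hframe (Sinv u)).mapL Sinv
  refine ⟨?_, hdual⟩
  obtain ⟨hA, hAB, -⟩ := hpf
  obtain ⟨hC, hCD, -⟩ := hqf
  have hB := hA.trans_le hAB
  have hD := hC.trans_le hCD
  have hAC : 0 < A * C := mul_pos hA hC
  have hBD : 0 < B * D := mul_pos hB hD
  have hle : A * C ≤ B * D := mul_le_mul hAB hCD hC.le hB.le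
  rw [← mul_pow, ← mul_pow]
  have hlower : A * C / (B * D) ^ 2 ≤ 1 / (B * D) := by
    rw [div_le_div_iff₀ (by positivity) hBD]
    nlinarith
  have hupper : 1 / (A * C) ≤ B * D / (A * C) ^ 2 := by
    rw [div_le_div_iff₀ hAC (by positivity)]
    nlinarith
  refine ⟨by positivity, hlower.trans ((one_div_le_one_div_of_le hAC hle).trans hupper),
    fun u => ?_⟩
  rw [(hasSum_inner_sq hdual u).tsum_eq]
  set w := Sinv u
  have hwu : S w = u := hSSinv u
  have hsq_le : ‖u‖ ^ 2 ≤ B * D * ⟪w, u⟫ := by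
    simpa only [hwu, real_inner_comm] using hpos.norm_apply_sq_le hupp w
  have hle_sq : A * C * ⟪w, u⟫ ≤ ‖u‖ ^ 2 := by
    have h₁ := hlow w
    have h₂ := norm_sub_sq_real u ((A * C) • w)
    rw [hwu, real_inner_comm] at h₁
    rw [real_inner_smul_right, norm_smul, Real.norm_of_nonneg hAC.le, mul_pow,
      real_inner_comm] at h₂
    nlinarith [sq_nonneg ‖u - (A * C) • w‖, mul_le_mul_of_nonneg_left h₁ hAC.le]
  constructor
  · refine (mul_le_mul_of_nonneg_right hlower (sq_nonneg _)).trans ?_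
    rw [one_div_mul_eq_div, div_le_iff₀' hBD]
    exact hsq_le
  · refine le_trans ?_ (mul_le_mul_of_nonneg_right hupper (sq_nonneg _))
    rw [one_div_mul_eq_div, le_div_iff₀' hAC]
    exact hle_sq
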